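/- Fix 1 ≤ p < ∞ and a sequence ν = (ν_n)_{n∈ℕ} of positive reals with Σ_{n=1}^∞ ν_n < ∞, let σ be the backward shift on ℓ^p(ν), K = {x ∈ ℓ^p(ν) : |x_n| ≤ 1 ∀n}, and for m ∈ ℕ set K_m = mK = {m·x : x ∈ K}. Then each K_m is a compact σ-invariant subset of ℓ^p(ν) and mdim_M(K_m, σ, ‖·‖_{ℓ^p(ν)}) = 1 for every m ∈ ℕ. -/

import Mathlib

open Filter Set MeasureTheory
open scoped ENNReal NNReal Topology

noncomputable section

variable {Y : Type*}

/-- The dynamical (Bowen) distance `d_n` associated to a distance function `d`. -/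
def dynDist (d : Y → Y → ℝ) (f : Y → Y) (n : ℕ) (x y : Y) : ℝ :=
  ⨆ j : Fin n, d (f^[(j : ℕ)] x) (f^[(j : ℕ)] y)

/-- The `(n,ε)`-dynamical ball around `x`. -/
def dynBall (d : Y → Y → ℝ) (f : Y → Y) (n : ℕ) (ε : ℝ) (x : Y) : Set Y :=
  {y | dynDist d f n x y < ε}

/-- A set `E` is `(n,ε)`-separated if distinct points of `E` are at `d_n`-distance `> ε`. -/
def IsDynSep (d : Y → Y → ℝ) (f : Y → Y) (n : ℕ) (ε : ℝ) (E : Set Y) : Prop :=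
  E.Pairwise fun x y => ε < dynDist d f n x y

/-- Maximal cardinality of an `(n,ε)`-separated subset of `P`. -/
def sepMaxCard (d : Y → Y → ℝ) (f : Y → Y) (n : ℕ) (ε : ℝ) (P : Set Y) : ℕ :=
  sSup {m | ∃ E : Finset Y, ↑E ⊆ P ∧ IsDynSep d f n ε ↑E ∧ E.card = m}

/-- `h(f,ε) = limsup_n (1/n) log s(f,n,ε)` (computed inside `P`). -/
def hSep (d : Y → Y → ℝ) (f : Y → Y) (P : Set Y) (ε : ℝ) : EReal :=
  Filter.limsup (fun n : ℕ => ((Real.log (sepMaxCard d f n ε P) / n : ℝ) : EReal)) Filter.atTop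

/-- Upper metric mean dimension (separated-sets version). -/
def mdimSep (d : Y → Y → ℝ) (f : Y → Y) (P : Set Y) : EReal :=
  Filter.limsup (fun ε : ℝ => hSep d f P ε * (((|Real.log ε|)⁻¹ : ℝ) : EReal))
    (nhdsWithin (0 : ℝ) (Set.Ioi 0))

/-- The Carathéodory sum `m(Z,s,N,ε)`: infimum over countable covers of `Z` by dynamical
balls of lengths `≥ N` of `Σ exp(−s·n_i)`. -/
def mCover (d : Y → Y → ℝ) (f : Y → Y) (Z : Set Y) (s : ℝ) (N : ℕ) (ε : ℝ) : ℝ≥0∞ :=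
  ⨅ (Γ : Set (Y × ℕ)) (_ : Γ.Countable) (_ : ∀ q ∈ Γ, N ≤ q.2)
    (_ : Z ⊆ ⋃ q ∈ Γ, dynBall d f q.2 ε q.1),
      ∑' q : Γ, ENNReal.ofReal (Real.exp (-(s * ((q : Y × ℕ).2 : ℝ))))

/-- `m(Z,s,ε) = lim_{N→∞} m(Z,s,N,ε)` (a monotone limit, hence a supremum). -/
def mCarat (d : Y → Y → ℝ) (f : Y → Y) (Z : Set Y) (s : ℝ) (ε : ℝ) : ℝ≥0∞ :=
  ⨆ N : ℕ, mCover d f Z s N ε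

/-- `h(Z,f,ε) = inf {s : m(Z,s,ε) = 0}`. -/
def hCov (d : Y → Y → ℝ) (f : Y → Y) (Z : Set Y) (ε : ℝ) : ℝ :=
  sInf {s : ℝ | mCarat d f Z s ε = 0}

/-- Upper metric mean dimension of `f` on the (possibly non-compact) subset `Z`. -/
def mdimC (d : Y → Y → ℝ) (f : Y → Y) (Z : Set Y) : EReal :=
  Filter.limsup (fun ε : ℝ => ((hCov d f Z ε * (|Real.log ε|)⁻¹ : ℝ) : EReal))
    (nhdsWithin (0 : ℝ) (Set.Ioi 0))

/-- Birkhoff average `(1/n) Σ_{j<n} φ(f^j x)`. -/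
def birkhoff (f : Y → Y) (φ : Y → ℝ) (n : ℕ) (x : Y) : ℝ :=
  (∑ j ∈ Finset.range n, φ (f^[j] x)) / n

/-- The level set `K_α`. -/
def Kset (f : Y → Y) (φ : Y → ℝ) (α : ℝ) : Set Y :=
  {x | Filter.Tendsto (fun n : ℕ => birkhoff f φ n x) Filter.atTop (nhds α)}

/-- The set `P(α,δ,n)`. -/
def Pset (f : Y → Y) (φ : Y → ℝ) (α δ : ℝ) (n : ℕ) : Set Y :=
  {x | |birkhoff f φ n x - α| < δ}

/-- Minimal number of `(n,ε)`-dynamical balls needed to cover `P`. -/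
def coverMinCard (d : Y → Y → ℝ) (f : Y → Y) (n : ℕ) (ε : ℝ) (P : Set Y) : ℕ :=
  sInf {m | ∃ F : Finset Y, F.card = m ∧ P ⊆ ⋃ x ∈ F, dynBall d f n ε x}

/-- `Λ_φ(α,ε) = lim_{δ→0} liminf_n (1/n) log N(α,δ,n,ε)` (a monotone limit, hence an
infimum over `δ > 0`). -/
def LambdaEps (d : Y → Y → ℝ) (f : Y → Y) (φ : Y → ℝ) (α ε : ℝ) : EReal :=
  ⨅ (δ : ℝ) (_ : 0 < δ),
    Filter.liminf (fun n : ℕ =>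
      ((Real.log (coverMinCard d f n ε (Pset f φ α δ n)) / n : ℝ) : EReal)) Filter.atTop

/-- `Λ_φ mdim_M(f,α,d) = limsup_{ε→0} Λ_φ(α,ε)/|log ε|`. -/
def LambdaMdim (d : Y → Y → ℝ) (f : Y → Y) (φ : Y → ℝ) (α : ℝ) : EReal :=
  Filter.limsup (fun ε : ℝ => LambdaEps d f φ α ε * (((|Real.log ε|)⁻¹ : ℝ) : EReal))
    (nhdsWithin (0 : ℝ) (Set.Ioi 0))

/-- A finite Borel partition of `X`. -/
structure FinBorelPartition (X : Type*) [MeasurableSpace X] where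
  parts : Finset (Set X)
  meas : ∀ s ∈ parts, MeasurableSet s
  cover : ∀ x : X, ∃ s ∈ parts, x ∈ s
  disj : ∀ s ∈ parts, ∀ t ∈ parts, s ≠ t → Disjoint s t

/-- The dynamical refinement `ξ^n = ⋁_{j=0}^{n−1} f^{−j} ξ` of a finite family of sets. -/
def dynRefine {X : Type*} (f : X → X) (P : Finset (Set X)) (n : ℕ) : Finset (Set X) :=
  letI := Classical.decEq (Set X)
  ((Finset.range n).pi fun _ => P).image fun c =>
    ⋂ (j : ℕ) (h : j ∈ Finset.range n), f^[j] ⁻¹' c j h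

/-- Entropy `H_μ(P) = Σ_C −μ(C) log μ(C)` of a finite family of sets. -/
def partEntropy {X : Type*} [MeasurableSpace X] (μ : Measure X) (P : Finset (Set X)) : ℝ :=
  ∑ s ∈ P, Real.negMulLog (μ s).toReal

/-- `h_μ(f,ξ) = lim_n (1/n) H_μ(ξ^n)`. -/
def dynEntropy {X : Type*} [MeasurableSpace X] (f : X → X) (μ : Measure X)
    (ξ : FinBorelPartition X) : ℝ :=
  Filter.limsup (fun n : ℕ => partEntropy μ (dynRefine f ξ.parts n) / n) Filter.atTop

/-- `H_φ mdim_M(f,α,d)`. -/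
def HphiMdim {X : Type*} [MetricSpace X] [MeasurableSpace X] (f : X → X) (φ : X → ℝ)
    (α : ℝ) : EReal :=
  Filter.limsup (fun ε : ℝ =>
    (⨆ (μ : ProbabilityMeasure X)
        (_ : Measure.map f (μ : Measure X) = (μ : Measure X) ∧
             ∫ x, φ x ∂(μ : Measure X) = α),
      ⨅ (ξ : FinBorelPartition X) (_ : ∀ s ∈ ξ.parts, Metric.diam s < ε),
        ((dynEntropy f (μ : Measure X) ξ : ℝ) : EReal)) * (((|Real.log ε|)⁻¹ : ℝ) : EReal))
    (nhdsWithin (0 : ℝ) (Set.Ioi 0))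

/-- The specification property. -/
def SpecificationProperty {X : Type*} [MetricSpace X] (f : X → X) : Prop :=
  ∀ ε : ℝ, 0 < ε → ∃ m : ℕ, ∀ (k : ℕ) (a b : Fin k → ℕ) (x : Fin k → X),
    (∀ j, a j ≤ b j) →
    (∀ (j : ℕ) (h : j + 1 < k), b ⟨j, Nat.lt_of_succ_lt h⟩ + m ≤ a ⟨j + 1, h⟩) →
    ∃ y : X, ∀ (j : Fin k) (p : ℕ), p ≤ b j - a j →
      dist (f^[p + a j] y) (f^[p] (x j)) < ε


/-- The distance function of a metric space, as a plain function. -/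
def mDist (X : Type*) [MetricSpace X] : X → X → ℝ := fun x y => dist x y

end

noncomputable section

/-- The `ℓ^p(ν)` distance between two real sequences. -/
def lpwDist (p : ℝ) (ν : ℕ → ℝ) (x y : ℕ → ℝ) : ℝ :=
  (∑' n : ℕ, |x n - y n| ^ p * ν n) ^ (1 / p)

/-- The backward shift on real sequences. -/
def shiftSeq (x : ℕ → ℝ) : ℕ → ℝ := fun n => x (n + 1)

/-- The set `K = {x : |x_n| ≤ 1 for all n}`. -/
def Kball : Set (ℕ → ℝ) := {x : ℕ → ℝ | ∀ n, |x n| ≤ 1}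

end

/-- The scaled set `K_m = m·K ⊆ ℓ^p(ν)`. -/
def Kscaled (m : ℕ) : Set (ℕ → ℝ) := (fun x : ℕ → ℝ => (m : ℝ) • x) '' Kball

theorem mem_Kscaled_iff {m : ℕ} (hm : 0 < m) {x : ℕ → ℝ} :
    x ∈ Kscaled m ↔ ∀ n, |x n| ≤ m := by
  have hm' : (0 : ℝ) < m := by exact_mod_cast hm
  constructor
  · rintro ⟨y, hy, rfl⟩ n
    simpa [abs_mul] using mul_le_mul_of_nonneg_left (hy n) hm'.le
  · intro h
    refine ⟨fun n => x n / m, fun n => ?_, ?_⟩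
    · rw [abs_div, abs_of_pos hm', div_le_one hm']
      exact h n
    · funext n
      simp only [Pi.smul_apply, smul_eq_mul]
      field_simp

theorem abs_sub_le_of_mem_Kscaled {m : ℕ} (hm : 0 < m) {x y : ℕ → ℝ} (hx : x ∈ Kscaled m)
    (hy : y ∈ Kscaled m) (i j : ℕ) : |x i - y j| ≤ 2 * m := by
  have h₁ := (mem_Kscaled_iff hm).1 hx i
  have h₂ := (mem_Kscaled_iff hm).1 hy j
  linarith [abs_sub (x i) (y j)]

theorem shiftSeq_image_Kscaled_subset (m : ℕ) : shiftSeq '' Kscaled m ⊆ Kscaled m := by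
  rintro _ ⟨_, ⟨y, hy, rfl⟩, rfl⟩
  exact ⟨shiftSeq y, fun n => hy (n + 1), rfl⟩

theorem shiftSeq_iterate (j : ℕ) (x : ℕ → ℝ) : shiftSeq^[j] x = fun n => x (n + j) := by
  induction j generalizing x with
  | zero => rfl
  | succ j ih =>
    rw [Function.iterate_succ_apply, ih]
    funext n
    rw [shiftSeq, add_assoc]

theorem summable_abs_sub_rpow_mul {p : ℝ} (hp : 0 ≤ p) {ν : ℕ → ℝ} (hν : ∀ n, 0 < ν n)
    (hsum : Summable ν) {x y : ℕ → ℝ} {R : ℝ} (hR : ∀ n, |x n - y n| ≤ R) :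
    Summable fun n => |x n - y n| ^ p * ν n := by
  refine Summable.of_nonneg_of_le (fun n => ?_) (fun n => ?_) (hsum.mul_left (R ^ p))
  · have := (hν n).le
    positivity
  · exact mul_le_mul_of_nonneg_right (Real.rpow_le_rpow (abs_nonneg _) (hR n) hp) (hν n).le

theorem lpwDist_le {p : ℝ} (hp : 0 < p) {ν : ℕ → ℝ} (hν : ∀ n, 0 < ν n)
    (hsum : Summable ν) {x y : ℕ → ℝ} {R δ ε : ℝ} {N : ℕ} (hR : ∀ n, |x n - y n| ≤ R)
    (hδ : ∀ n < N, |x n - y n| ≤ δ) (hδ₀ : 0 ≤ δ) (hε : 0 ≤ ε)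
    (h : δ ^ p * ∑' n, ν n + R ^ p * ∑' n, ν (n + N) ≤ ε ^ p) :
    lpwDist p ν x y ≤ ε := by
  have hs := summable_abs_sub_rpow_mul hp.le hν hsum hR
  have htail : ∑' n, |x (n + N) - y (n + N)| ^ p * ν (n + N) ≤ R ^ p * ∑' n, ν (n + N) := by
    rw [← tsum_mul_left]
    refine Summable.tsum_le_tsum (fun n => ?_) ((summable_nat_add_iff N).2 hs)
      (((summable_nat_add_iff N).2 hsum).mul_left _)
    exact mul_le_mul_of_nonneg_right (Real.rpow_le_rpow (abs_nonneg _) (hR _) hp.le) (hν _).le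
  have hhead : ∑ n ∈ Finset.range N, |x n - y n| ^ p * ν n ≤ δ ^ p * ∑' n, ν n := by
    calc _ ≤ ∑ n ∈ Finset.range N, δ ^ p * ν n := by
          refine Finset.sum_le_sum fun n hn => ?_
          exact mul_le_mul_of_nonneg_right
            (Real.rpow_le_rpow (abs_nonneg _) (hδ n (Finset.mem_range.1 hn)) hp.le) (hν n).le
      _ = δ ^ p * ∑ n ∈ Finset.range N, ν n := by rw [Finset.mul_sum]
      _ ≤ _ := mul_le_mul_of_nonneg_left
          (hsum.sum_le_tsum _ fun n _ => (hν n).le) (Real.rpow_nonneg hδ₀ p)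
  have hle : ∑' n, |x n - y n| ^ p * ν n ≤ ε ^ p := by
    rw [← hs.sum_add_tsum_nat_add N]
    linarith
  rw [lpwDist, one_div, Real.rpow_inv_le_iff_of_pos _ hε hp]
  · exact hle
  · exact tsum_nonneg fun n => mul_nonneg (Real.rpow_nonneg (abs_nonneg _) p) (hν n).le

theorem mul_abs_sub_zero_le_lpwDist {p : ℝ} (hp : 0 < p) {ν : ℕ → ℝ} (hν : ∀ n, 0 < ν n)
    (hsum : Summable ν) {x y : ℕ → ℝ} {R : ℝ} (hR : ∀ n, |x n - y n| ≤ R) :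
    ν 0 ^ (1 / p) * |x 0 - y 0| ≤ lpwDist p ν x y := by
  have hs := summable_abs_sub_rpow_mul hp.le hν hsum hR
  have h₀ : |x 0 - y 0| ^ p * ν 0 ≤ ∑' n, |x n - y n| ^ p * ν n :=
    hs.le_tsum 0 fun n _ => mul_nonneg (Real.rpow_nonneg (abs_nonneg _) p) (hν n).le
  have h₁ := Real.rpow_le_rpow
    (mul_nonneg (Real.rpow_nonneg (abs_nonneg _) p) (hν 0).le) h₀ (one_div_pos.2 hp).le
  rwa [Real.mul_rpow (Real.rpow_nonneg (abs_nonneg _) p) (hν 0).le, ← Real.rpow_mul (abs_nonneg _),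
    mul_one_div_cancel hp.ne', Real.rpow_one, mul_comm] at h₁

theorem exists_subseq_tendsto_lpwDist {p : ℝ} (hp : 0 < p) {ν : ℕ → ℝ} (hν : ∀ n, 0 < ν n)
    (hsum : Summable ν) {m : ℕ} (hm : 0 < m) (u : ℕ → ℕ → ℝ) (hu : ∀ k, u k ∈ Kscaled m) :
    ∃ x ∈ Kscaled m, ∃ ψ : ℕ → ℕ, StrictMono ψ ∧
      Tendsto (fun k => lpwDist p ν (u (ψ k)) x) atTop (𝓝 0) := by
  have hK : IsCompact (Set.univ.pi fun _ : ℕ => Set.Icc (-(m : ℝ)) m) :=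
    isCompact_univ_pi fun _ => isCompact_Icc
  obtain ⟨x, hx, ψ, hψ, hlim⟩ := hK.tendsto_subseq (x := u) fun k n _ =>
    abs_le.1 ((mem_Kscaled_iff hm).1 (hu k) n)
  have hxK : x ∈ Kscaled m := (mem_Kscaled_iff hm).2 fun n => abs_le.2 (hx n trivial)
  refine ⟨x, hxK, ψ, hψ, ?_⟩
  have hsumlim : Tendsto (fun k => ∑' n, |u (ψ k) n - x n| ^ p * ν n) atTop
      (𝓝 (∑' _ : ℕ, (0 : ℝ))) := by
    refine tendsto_tsum_of_dominated_convergence (hsum.mul_left ((2 * m : ℝ) ^ p))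
      (fun n => ?_) (Eventually.of_forall fun k n => ?_)
    · have h₁ : Tendsto (fun k => |u (ψ k) n - x n|) atTop (𝓝 0) := by
        simpa using ((tendsto_pi_nhds.1 hlim n).sub_const (x n)).abs
      simpa [Real.zero_rpow hp.ne'] using
        (h₁.rpow_const (p := p) (Or.inr hp.le)).mul_const (ν n)
    · rw [Real.norm_of_nonneg (mul_nonneg (Real.rpow_nonneg (abs_nonneg _) p) (hν n).le)]
      exact mul_le_mul_of_nonneg_right (Real.rpow_le_rpow (abs_nonneg _)
        (abs_sub_le_of_mem_Kscaled hm (hu _) hxK n n) hp.le) (hν n).le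
  have h := hsumlim.rpow_const (p := 1 / p) (Or.inr (one_div_pos.2 hp).le)
  simpa [lpwDist, Real.zero_rpow (inv_pos.2 hp).ne'] using h

theorem card_le_of_isDynSep {p : ℝ} (hp : 0 < p) {ν : ℕ → ℝ} (hν : ∀ n, 0 < ν n)
    (hsum : Summable ν) {m : ℕ} (hm : 0 < m) {δ ε : ℝ} (hδ : 0 < δ) (hε : 0 ≤ ε) {N : ℕ}
    (h : δ ^ p * ∑' n, ν n + (2 * m : ℝ) ^ p * ∑' n, ν (n + N) ≤ ε ^ p) (n : ℕ)
    {E : Finset (ℕ → ℝ)} (hE : ↑E ⊆ Kscaled m)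
    (hsep : IsDynSep (lpwDist p ν) shiftSeq n ε (E : Set (ℕ → ℝ))) :
    E.card ≤ (⌊2 * m / δ⌋₊ + 1) ^ (n + N) := by
  have hnn : ∀ x ∈ E, ∀ j, 0 ≤ (x j + m) / δ := fun x hx j => by
    have := (abs_le.1 ((mem_Kscaled_iff hm).1 (hE hx) j)).1
    exact div_nonneg (by linarith) hδ.le
  let F : E → Fin (n + N) → Fin (⌊2 * m / δ⌋₊ + 1) := fun x j =>
    ⟨⌊((x : ℕ → ℝ) j + m) / δ⌋₊, Nat.lt_succ_of_le <| Nat.floor_mono <| by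
      have := (abs_le.1 ((mem_Kscaled_iff hm).1 (hE x.2) j)).2
      exact div_le_div_of_nonneg_right (by linarith) hδ.le⟩
  have hF : Function.Injective F := by
    rintro ⟨x, hx⟩ ⟨y, hy⟩ hxy
    by_contra hne
    have hclose : ∀ j < n + N, |x j - y j| ≤ δ := fun j hj => by
      have hfl : ⌊(x j + m) / δ⌋₊ = ⌊(y j + m) / δ⌋₊ :=
        congrArg Fin.val (congrFun hxy ⟨j, hj⟩)
      have hx₁ := Nat.floor_le (hnn x hx j)
      have hx₂ := Nat.lt_floor_add_one ((x j + m) / δ)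
      have hy₁ := Nat.floor_le (hnn y hy j)
      have hy₂ := Nat.lt_floor_add_one ((y j + m) / δ)
      rw [hfl] at hx₁ hx₂
      have hsub : (x j + m) / δ - (y j + m) / δ = (x j - y j) / δ := by ring
      have : |(x j - y j) / δ| ≤ 1 := by
        rw [← hsub, abs_le]
        constructor <;> linarith
      rwa [abs_div, abs_of_pos hδ, div_le_one hδ] at this
    have hlt := hsep hx hy fun hxy' => hne (Subtype.ext hxy')
    refine absurd hlt (not_lt.2 (Real.iSup_le (fun i => ?_) hε))
    rw [shiftSeq_iterate, shiftSeq_iterate]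
    exact lpwDist_le hp hν hsum
      (fun k => abs_sub_le_of_mem_Kscaled hm (hE hx) (hE hy) _ _)
      (fun k hk => hclose _ (by have := i.2; omega)) hδ.le hε h
  simpa using Fintype.card_le_of_injective F hF

theorem sepMaxCard_le {Y : Type*} {d : Y → Y → ℝ} {f : Y → Y} {n : ℕ} {ε : ℝ} {P : Set Y} {B : ℕ}
    (h : ∀ E : Finset Y, ↑E ⊆ P → IsDynSep d f n ε (E : Set Y) → E.card ≤ B) :
    sepMaxCard d f n ε P ≤ B :=
  csSup_le ⟨0, ∅, by simp, by simp [IsDynSep], rfl⟩ fun _ ⟨E, hE, hs, hc⟩ => hc ▸ h E hE hs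

theorem card_le_sepMaxCard {Y : Type*} {d : Y → Y → ℝ} {f : Y → Y} {n : ℕ} {ε : ℝ} {P : Set Y}
    {B : ℕ} (h : ∀ E : Finset Y, ↑E ⊆ P → IsDynSep d f n ε (E : Set Y) → E.card ≤ B)
    {E : Finset Y} (hE : ↑E ⊆ P) (hs : IsDynSep d f n ε (E : Set Y)) :
    E.card ≤ sepMaxCard d f n ε P :=
  le_csSup ⟨B, fun _ ⟨E, hE, hs, hc⟩ => hc ▸ h E hE hs⟩ ⟨E, hE, hs, rfl⟩

theorem exists_isDynSep_card_eq {p : ℝ} (hp : 0 < p) {ν : ℕ → ℝ} (hν : ∀ n, 0 < ν n)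
    (hsum : Summable ν) {m : ℕ} (hm : 0 < m) {δ ε : ℝ} (hδ : 0 < δ)
    (hδε : ε < ν 0 ^ (1 / p) * δ) (n : ℕ) :
    ∃ E : Finset (ℕ → ℝ), ↑E ⊆ Kscaled m ∧
      IsDynSep (lpwDist p ν) shiftSeq n ε (E : Set (ℕ → ℝ)) ∧
      E.card = (⌊m / δ⌋₊ + 1) ^ n := by
  let F : (Fin n → Fin (⌊m / δ⌋₊ + 1)) → ℕ → ℝ := fun a j =>
    if hj : j < n then (a ⟨j, hj⟩ : ℕ) * δ else 0
  have hFK : ∀ a, F a ∈ Kscaled m := fun a => (mem_Kscaled_iff hm).2 fun j => by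
    by_cases hj : j < n
    · simp only [F, hj, dif_pos]
      rw [abs_of_nonneg (by positivity), ← le_div_iff₀ hδ]
      exact (Nat.le_floor_iff (by positivity)).1 (Nat.lt_succ_iff.1 (a ⟨j, hj⟩).2)
    · simp [F, hj]
  have hsep : ∀ a b, a ≠ b → ε < dynDist (lpwDist p ν) shiftSeq n (F a) (F b) := fun a b hab => by
    obtain ⟨i, hi⟩ := Function.ne_iff.1 hab
    have hgap : δ ≤ |F a i - F b i| := by
      have hF : F a i - F b i = (((a i : ℕ) : ℤ) - ((b i : ℕ) : ℤ) : ℤ) * δ := by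
        simp [F, sub_mul]
      have hne : (((a i : ℕ) : ℤ) - ((b i : ℕ) : ℤ)) ≠ 0 := by
        have := Fin.val_ne_of_ne hi
        omega
      have hone : (1 : ℝ) ≤ |((((a i : ℕ) : ℤ) - ((b i : ℕ) : ℤ) : ℤ) : ℝ)| := by
        exact_mod_cast Int.one_le_abs hne
      rw [hF, abs_mul, abs_of_pos hδ]
      nlinarith
    have hdist : ν 0 ^ (1 / p) * |F a i - F b i| ≤
        lpwDist p ν (shiftSeq^[(i : ℕ)] (F a)) (shiftSeq^[(i : ℕ)] (F b)) := by
      rw [shiftSeq_iterate, shiftSeq_iterate]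
      simpa using mul_abs_sub_zero_le_lpwDist hp hν hsum (x := fun k => F a (k + i))
        (y := fun k => F b (k + i))
        fun k => abs_sub_le_of_mem_Kscaled hm (hFK a) (hFK b) _ _
    calc ε < ν 0 ^ (1 / p) * δ := hδε
      _ ≤ ν 0 ^ (1 / p) * |F a i - F b i| :=
        mul_le_mul_of_nonneg_left hgap (Real.rpow_nonneg (hν 0).le _)
      _ ≤ _ := hdist
      _ ≤ _ := le_ciSup (f := fun j : Fin n =>
          lpwDist p ν (shiftSeq^[(j : ℕ)] (F a)) (shiftSeq^[(j : ℕ)] (F b)))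
          (Set.finite_range _).bddAbove i
  have hinj : Function.Injective F := fun a b hab => by
    by_contra hne
    obtain ⟨i, hi⟩ := Function.ne_iff.1 hne
    have h₁ := congrFun hab i
    simp only [F, i.2, dif_pos, Fin.eta] at h₁
    exact hi (Fin.ext (by exact_mod_cast mul_right_cancel₀ hδ.ne' h₁))
  refine ⟨Finset.univ.map ⟨F, hinj⟩, ?_, ?_, by simp⟩
  · intro x hx
    obtain ⟨a, -, rfl⟩ := Finset.mem_map.1 (Finset.mem_coe.1 hx)
    exact hFK a
  · intro x hx y hy hxy
    obtain ⟨a, -, rfl⟩ := Finset.mem_map.1 (Finset.mem_coe.1 hx)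
    obtain ⟨b, -, rfl⟩ := Finset.mem_map.1 (Finset.mem_coe.1 hy)
    exact hsep a b fun hab => hxy (hab ▸ rfl)

theorem hSep_le_log {Y : Type*} {d : Y → Y → ℝ} {f : Y → Y} {P : Set Y} {ε : ℝ} {M N : ℕ}
    (h : ∀ n, sepMaxCard d f n ε P ≤ M ^ (n + N)) :
    hSep d f P ε ≤ (Real.log M : EReal) := by
  have hlim : Tendsto (fun n : ℕ => ((Real.log M + N * Real.log M / n : ℝ) : EReal)) atTop
      (𝓝 (Real.log M : EReal)) := by
    refine (continuous_coe_real_ereal.tendsto _).comp ?_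
    simpa using (tendsto_const_div_atTop_nhds_zero_nat (N * Real.log M)).const_add (Real.log M)
  rw [hSep, ← hlim.limsup_eq]
  refine limsup_le_limsup ?_
  filter_upwards [eventually_gt_atTop 0] with n hn
  have hn' : (0 : ℝ) < n := by exact_mod_cast hn
  rw [EReal.coe_le_coe_iff, div_le_iff₀ hn']
  have hlogM : 0 ≤ Real.log M := Real.log_natCast_nonneg M
  have hrhs : (Real.log M + N * Real.log M / n) * n = (n + N : ℕ) * Real.log M := by
    push_cast
    field_simp
  rw [hrhs, ← Real.log_pow]
  rcases Nat.eq_zero_or_pos (sepMaxCard d f n ε P) with h0 | h0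
  · rw [h0, Nat.cast_zero, Real.log_zero, Real.log_pow]
    positivity
  · exact Real.log_le_log (by exact_mod_cast h0) (by exact_mod_cast h n)

theorem log_le_hSep {Y : Type*} {d : Y → Y → ℝ} {f : Y → Y} {P : Set Y} {ε : ℝ} {L : ℕ}
    (hL : 0 < L) (h : ∀ n, L ^ n ≤ sepMaxCard d f n ε P) :
    (Real.log L : EReal) ≤ hSep d f P ε := by
  rw [hSep, ← limsup_const (f := (atTop : Filter ℕ)) (Real.log L : EReal)]
  refine limsup_le_limsup ?_
  filter_upwards [eventually_gt_atTop 0] with n hn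
  have hn' : (0 : ℝ) < n := by exact_mod_cast hn
  rw [EReal.coe_le_coe_iff, le_div_iff₀ hn', mul_comm, ← Real.log_pow]
  exact Real.log_le_log (by positivity) (by exact_mod_cast h n)

theorem mdimSep_eq_one_of_log_bounds {Y : Type*} {d : Y → Y → ℝ} {f : Y → Y} {P : Set Y}
    {c C : ℝ} (hc : 0 < c) (hC : 0 < C)
    (hlow : ∀ᶠ ε in 𝓝[>] (0 : ℝ), (Real.log (c / ε) : EReal) ≤ hSep d f P ε)
    (hupp : ∀ᶠ ε in 𝓝[>] (0 : ℝ), hSep d f P ε ≤ (Real.log (C / ε) : EReal)) :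
    mdimSep d f P = 1 := by
  have hlog : Tendsto (fun ε : ℝ => |Real.log ε|) (𝓝[>] 0) atTop :=
    tendsto_abs_atBot_atTop.comp Real.tendsto_log_nhdsGT_zero
  have hlim : ∀ b : ℝ, 0 < b → Tendsto (fun ε : ℝ =>
      (Real.log (b / ε) : EReal) * ((|Real.log ε|⁻¹ : ℝ) : EReal)) (𝓝[>] 0) (𝓝 1) := by
    intro b hb
    have hreal : Tendsto (fun ε : ℝ => Real.log b * |Real.log ε|⁻¹ + 1) (𝓝[>] 0) (𝓝 1) := by
      simpa using (hlog.inv_tendsto_atTop.const_mul (Real.log b)).add_const 1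
    have hcoe := (continuous_coe_real_ereal.tendsto 1).comp hreal
    rw [EReal.coe_one] at hcoe
    refine hcoe.congr' ?_
    filter_upwards [Ioo_mem_nhdsGT (zero_lt_one' ℝ)] with ε hε
    have hneg := Real.log_neg hε.1 hε.2
    rw [Function.comp_apply, ← EReal.coe_mul, Real.log_div hb.ne' hε.1.ne', abs_of_neg hneg]
    congr 1
    have := hneg.ne
    field_simp
    ring
  refine Tendsto.limsup_eq (tendsto_of_tendsto_of_tendsto_of_le_of_le' (hlim c hc) (hlim C hC)
    ?_ ?_)
  · filter_upwards [hlow] with ε hε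
    exact mul_le_mul_of_nonneg_right hε (EReal.coe_nonneg.2 (by positivity))
  · filter_upwards [hupp] with ε hε
    exact mul_le_mul_of_nonneg_right hε (EReal.coe_nonneg.2 (by positivity))

theorem exists_tail_bound {p : ℝ} (hp : 0 < p) {ν : ℕ → ℝ} (hν : ∀ n, 0 < ν n)
    (hsum : Summable ν) {R ε : ℝ} (hε : 0 < ε) :
    ∃ N : ℕ, ((2 * ∑' n, ν n) ^ (-(1 / p)) * ε) ^ p * ∑' n, ν n +
      R ^ p * ∑' n, ν (n + N) ≤ ε ^ p := by
  have hA : 0 < ∑' n, ν n := hsum.tsum_pos (fun n => (hν n).le) 0 (hν 0)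
  have hεp : 0 < ε ^ p := Real.rpow_pos_of_pos hε p
  have htail : Tendsto (fun N => R ^ p * ∑' n, ν (n + N)) atTop (𝓝 0) := by
    simpa using (tendsto_sum_nat_add ν).const_mul (R ^ p)
  obtain ⟨N, hN⟩ := (htail.eventually_le_const (half_pos hεp)).exists
  refine ⟨N, ?_⟩
  have hhead : ((2 * ∑' n, ν n) ^ (-(1 / p)) * ε) ^ p * ∑' n, ν n = ε ^ p / 2 := by
    rw [Real.mul_rpow (by positivity) hε.le, ← Real.rpow_mul (by positivity), neg_mul,
      one_div_mul_cancel hp.ne', Real.rpow_neg_one]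
    field_simp
  linarith

theorem mdimSep_shiftSeq_Kscaled {p : ℝ} (hp : 0 < p) {ν : ℕ → ℝ} (hν : ∀ n, 0 < ν n)
    (hsum : Summable ν) {m : ℕ} (hm : 0 < m) :
    mdimSep (lpwDist p ν) shiftSeq (Kscaled m) = 1 := by
  have hm' : (0 : ℝ) < m := by exact_mod_cast hm
  have hA : 0 < ∑' n, ν n := hsum.tsum_pos (fun n => (hν n).le) 0 (hν 0)
  set D : ℝ := (2 * ∑' n, ν n) ^ (-(1 / p)) with hD
  have hD₀ : 0 < D := Real.rpow_pos_of_pos (by positivity) _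
  set w : ℝ := ν 0 ^ (1 / p) with hw
  have hw₀ : 0 < w := Real.rpow_pos_of_pos (hν 0) _
  have hupp : ∀ ε : ℝ, 0 < ε → ∃ N : ℕ, ∀ n, ∀ E : Finset (ℕ → ℝ), ↑E ⊆ Kscaled m →
      IsDynSep (lpwDist p ν) shiftSeq n ε (E : Set (ℕ → ℝ)) →
      E.card ≤ (⌊2 * m / (D * ε)⌋₊ + 1) ^ (n + N) := fun ε hε => by
    obtain ⟨N, hN⟩ := exists_tail_bound hp hν hsum (R := 2 * m) hε
    exact ⟨N, fun n E hE hs =>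
      card_le_of_isDynSep hp hν hsum hm (mul_pos hD₀ hε) hε.le hN n hE hs⟩
  refine mdimSep_eq_one_of_log_bounds (c := m * w / 2) (C := 2 * m / D + 1)
    (by positivity) (by positivity) ?_ ?_
  · filter_upwards [self_mem_nhdsWithin] with ε (hε : 0 < ε)
    obtain ⟨N, hN⟩ := hupp ε hε
    have hδ : 0 < 2 * ε / w := by positivity
    refine le_trans ?_ (log_le_hSep (L := ⌊m / (2 * ε / w)⌋₊ + 1) (Nat.succ_pos _) fun n => ?_)
    · rw [EReal.coe_le_coe_iff]
      refine Real.log_le_log (by positivity) ?_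
      have hfl := (Nat.lt_floor_add_one (m / (2 * ε / w))).le
      have heq : (m : ℝ) / (2 * ε / w) = m * w / 2 / ε := by field_simp
      push_cast
      rwa [← heq]
    · obtain ⟨E, hE, hs, hcard⟩ := exists_isDynSep_card_eq hp hν hsum hm hδ
        (show ε < w * (2 * ε / w) by rw [mul_div_cancel₀ _ hw₀.ne']; linarith) n
      exact hcard ▸ card_le_sepMaxCard (hN n) hE hs
  · filter_upwards [Ioo_mem_nhdsGT (zero_lt_one' ℝ)] with ε hε
    obtain ⟨N, hN⟩ := hupp ε hε.1
    refine (hSep_le_log fun n => sepMaxCard_le (hN n)).trans ?_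
    rw [EReal.coe_le_coe_iff]
    refine Real.log_le_log (by positivity) ?_
    have hε₀ := hε.1
    have hfl := Nat.floor_le (show (0 : ℝ) ≤ 2 * m / (D * ε) by positivity)
    have hone : 1 ≤ 1 / ε := (one_le_div hε.1).2 hε.2.le
    have heq : (2 * m / D + 1) / ε = 2 * m / (D * ε) + 1 / ε := by field_simp
    push_cast
    rw [heq]
    linarith

/-- Each `K_m = mK` is a compact (here: sequentially compact for the `ℓ^p(ν)` distance)
`σ`-invariant subset of `ℓ^p(ν)`, and `mdim_M(K_m, σ, ‖·‖_{ℓ^p(ν)}) = 1` for every `m`. -/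
theorem mdim_shift_on_Km_eq_one (p : ℝ) (hp : 1 ≤ p) (ν : ℕ → ℝ)
    (hν : ∀ n, 0 < ν n) (hsum : Summable ν) (m : ℕ) (hm : 0 < m) :
    (shiftSeq '' Kscaled m ⊆ Kscaled m) ∧
    (∀ u : ℕ → ℕ → ℝ, (∀ k, u k ∈ Kscaled m) → ∃ x ∈ Kscaled m, ∃ ψ : ℕ → ℕ,
      StrictMono ψ ∧
      Filter.Tendsto (fun k => lpwDist p ν (u (ψ k)) x) Filter.atTop (nhds 0)) ∧
    mdimSep (lpwDist p ν) shiftSeq (Kscaled m) = 1 := by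
  have hp₀ : 0 < p := zero_lt_one.trans_le hp
  exact ⟨shiftSeq_image_Kscaled_subset m, exists_subseq_tendsto_lpwDist hp₀ hν hsum hm,
    mdimSep_shiftSeq_Kscaled hp₀ hν hsum hm⟩
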